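/- arXiv:1812.10911 — 3 statements merged into one kernel-verified Lean document; each statement's English description precedes it below -/
import Mathlib

section
/- Let ε ~ N(0, I_m) be an m-dimensional standard Gaussian random vector and, for a > 0, let ζ_{m,a} have the conditional distribution of ε given ε'ε ≤ a. Then ζ_{m,a} is more peaked than ε: for every symmetric convex set K ⊂ ℝ^m, P(ζ_{m,a} ∈ K) ≥ P(ε ∈ K). -/
open MeasureTheory ProbabilityTheory BigOperators

/-- The standard Gaussian measure `N(0, I_m)` on `ℝ^m`, as the product of `m` i.i.d. standard
real Gaussians. -/
noncomputable def stdGaussian (m : ℕ) : Measure (Fin m → ℝ) :=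
  Measure.pi fun _ => gaussianReal 0 1

open Metric Set in
lemma polar_aux {E : Type*} [NormedAddCommGroup E] [NormedSpace ℝ E] [MeasurableSpace E]
    [BorelSpace E] [FiniteDimensional ℝ E] [Nontrivial E] (μ : Measure E) [μ.IsAddHaarMeasure]
    (g : ℝ → ENNReal) (hg : Measurable g) (S : Set E) (hS : MeasurableSet S) :
    (μ.withDensity (fun x => g ‖x‖)) S =
      ∫⁻ θ : sphere (0 : E) 1, ((Measure.volumeIoiPow (Module.finrank ℝ E - 1)).withDensity
        (fun r => g r.1)) {r | r.1 • θ.1 ∈ S} ∂μ.toSphere := by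
  have hmS : Measurable fun p : sphere (0 : E) 1 × Ioi (0 : ℝ) => p.2.1 • p.1.1 := by
    have : Continuous fun p : sphere (0 : E) 1 × Ioi (0 : ℝ) => p.2.1 • p.1.1 := by fun_prop
    exact this.measurable
  rw [withDensity_apply _ hS, ← lintegral_indicator hS]
  have hf : Measurable (S.indicator fun x : E => g ‖x‖) :=
    (hg.comp measurable_norm).indicator hS
  have h1 : ∫⁻ x, S.indicator (fun x : E => g ‖x‖) x ∂μ
      = ∫⁻ x : ({(0)}ᶜ : Set E), S.indicator (fun x : E => g ‖x‖) x.1 ∂(μ.comap (↑)) := by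
    rw [lintegral_subtype_comap (measurableSet_singleton _).compl
      (S.indicator (fun x : E => g ‖x‖)), restrict_compl_singleton]
  have hF : Measurable fun p : sphere (0 : E) 1 × Ioi (0 : ℝ) =>
      S.indicator (fun x : E => g ‖x‖) (p.2.1 • p.1.1) := hf.comp hmS
  rw [h1]
  have h2 := μ.measurePreserving_homeomorphUnitSphereProd.lintegral_comp hF
  have h3 : ∀ x : ({(0)}ᶜ : Set E), ((homeomorphUnitSphereProd E x).2.1 •
      (homeomorphUnitSphereProd E x).1.1 : E) = x.1 := by
    intro x
    have := (homeomorphUnitSphereProd E).symm_apply_apply x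
    conv_rhs => rw [← this]
    rfl
  simp only [h3] at h2
  rw [h2, lintegral_prod _ hF.aemeasurable]
  refine lintegral_congr fun θ => ?_
  have hT : MeasurableSet {r : Ioi (0 : ℝ) | r.1 • θ.1 ∈ S} :=
    (hmS.comp (measurable_const.prodMk measurable_id : Measurable fun r : Ioi (0 : ℝ) => (θ, r))) hS
  rw [withDensity_apply _ hT, ← lintegral_indicator hT]
  refine lintegral_congr fun r => ?_
  have hn : ‖r.1 • θ.1‖ = r.1 := by
    rw [norm_smul]; simp [abs_of_pos r.2.out]
  by_cases h : r.1 • θ.1 ∈ S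
  · rw [indicator_of_mem h, indicator_of_mem (by exact h), hn]
  · rw [indicator_of_notMem h, indicator_of_notMem (by exact h)]

open Metric Set in
lemma core_aux {E : Type*} [NormedAddCommGroup E] [NormedSpace ℝ E] [MeasurableSpace E]
    [BorelSpace E] [FiniteDimensional ℝ E] [Nontrivial E] (μ : Measure E) [μ.IsAddHaarMeasure]
    (g : ℝ → ENNReal) (hg : Measurable g) (hp : IsProbabilityMeasure (μ.withDensity fun x => g ‖x‖))
    (K : Set E) (hK : MeasurableSet K) (hstar : ∀ x ∈ K, ∀ c : ℝ, 0 ≤ c → c ≤ 1 → c • x ∈ K)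
    (b : ℝ) :
    (μ.withDensity fun x => g ‖x‖) K * (μ.withDensity fun x => g ‖x‖) (closedBall 0 b) ≤
      (μ.withDensity fun x => g ‖x‖) (K ∩ closedBall 0 b) := by
  have hu := polar_aux μ g hg univ MeasurableSet.univ
  have hB := polar_aux μ g hg (closedBall 0 b) measurableSet_closedBall
  have hKB := polar_aux μ g hg (K ∩ closedBall 0 b) (hK.inter measurableSet_closedBall)
  have hK' := polar_aux μ g hg K hK
  set P := μ.withDensity fun x => g ‖x‖
  set ν := (Measure.volumeIoiPow (Module.finrank ℝ E - 1)).withDensity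
        (fun r : Ioi (0 : ℝ) => g r.1) with hν
  set σ := μ.toSphere
  have hsf : SFinite ν := by rw [hν]; infer_instance
  have hn : ∀ (r : Ioi (0 : ℝ)) (θ : sphere (0 : E) 1), ‖r.1 • θ.1‖ = r.1 := by
    intro r θ; rw [norm_smul]; simp [abs_of_pos r.2.out]
  have hmeas : ∀ S : Set E, MeasurableSet S →
      Measurable fun θ : sphere (0 : E) 1 => ν {r : Ioi (0 : ℝ) | r.1 • θ.1 ∈ S} := by
    intro S hS
    have hmS : Measurable fun p : sphere (0 : E) 1 × Ioi (0 : ℝ) => p.2.1 • p.1.1 := by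
      have : Continuous fun p : sphere (0 : E) 1 × Ioi (0 : ℝ) => p.2.1 • p.1.1 := by fun_prop
      exact this.measurable
    exact measurable_measure_prodMk_left (hmS hS)
  simp only [mem_univ, ofPred_true, lintegral_const, measure_univ] at hu
  simp only [mem_closedBall, dist_zero_right, hn, lintegral_const] at hB
  have key : ∀ θ : sphere (0 : E) 1, ν {r : Ioi (0 : ℝ) | r.1 • θ.1 ∈ K} * ν {r | r.1 ≤ b} ≤
      ν univ * ν {r : Ioi (0 : ℝ) | r.1 • θ.1 ∈ K ∩ closedBall 0 b} := by
    intro θ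
    have e : {r : Ioi (0 : ℝ) | r.1 • θ.1 ∈ K ∩ closedBall 0 b} =
      {r : Ioi (0 : ℝ) | r.1 • θ.1 ∈ K} ∩ {r | r.1 ≤ b} := by
      ext r; simp [hn]
    rw [e]
    by_cases h : {r : Ioi (0 : ℝ) | r.1 • θ.1 ∈ K} ⊆ {r | r.1 ≤ b}
    · rw [inter_eq_left.2 h, mul_comm]
      gcongr
      exact subset_univ _
    · have h' : {r : Ioi (0 : ℝ) | r.1 ≤ b} ⊆ {r : Ioi (0 : ℝ) | r.1 • θ.1 ∈ K} := by
        obtain ⟨s, hs, hsb⟩ := not_subset.1 h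
        intro r hr
        simp only [mem_ofPred_eq, not_le] at hs hsb hr ⊢
        have hs0 : 0 < s.1 := s.2
        have hr0 : 0 < r.1 := r.2
        have := hstar _ hs (r.1 / s.1) (by positivity) (by rw [div_le_one hs0]; linarith)
        rwa [smul_smul, div_mul_cancel₀ _ hs0.ne'] at this
      rw [inter_eq_right.2 h']
      gcongr
      exact subset_univ _
  calc P K * P (closedBall 0 b)
      = σ univ * ∫⁻ θ : sphere (0 : E) 1,
          ν {r : Ioi (0 : ℝ) | r.1 • θ.1 ∈ K} * ν {r | r.1 ≤ b} ∂σ := by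
        rw [lintegral_mul_const _ (hmeas K hK), ← hK', hB]; ring
    _ ≤ σ univ * ∫⁻ θ : sphere (0 : E) 1,
          ν univ * ν {r : Ioi (0 : ℝ) | r.1 • θ.1 ∈ K ∩ closedBall 0 b} ∂σ := by
        exact mul_le_mul_right (lintegral_mono key) _
    _ = P (K ∩ closedBall 0 b) := by
        rw [lintegral_const_mul _ (hmeas _ (hK.inter measurableSet_closedBall)), ← hKB, ← mul_assoc,
          mul_comm (σ univ), ← hu, one_mul]

lemma pi_density_aux (m : ℕ) : _root_.stdGaussian m =
    (volume : Measure (Fin m → ℝ)).withDensity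
      (fun x => ENNReal.ofReal (∏ i, gaussianPDFReal 0 1 (x i))) := by
  unfold _root_.stdGaussian
  refine Measure.pi_eq fun s hs => ?_
  rw [withDensity_apply _ (MeasurableSet.univ_pi hs), ← lintegral_indicator (MeasurableSet.univ_pi hs)]
  have e : ∀ x : Fin m → ℝ, (Set.univ.pi s).indicator
      (fun x => ENNReal.ofReal (∏ i, gaussianPDFReal 0 1 (x i))) x =
      ENNReal.ofReal (∏ i, (s i).indicator (gaussianPDFReal 0 1) (x i)) := by
    intro x
    by_cases h : x ∈ Set.univ.pi s
    · rw [Set.indicator_of_mem h]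
      congr 1
      refine Finset.prod_congr rfl fun i _ => ?_
      rw [Set.indicator_of_mem (h i trivial)]
    · rw [Set.indicator_of_notMem h]
      simp only [Set.mem_pi, Set.mem_univ, true_imp_iff, not_forall] at h
      obtain ⟨i, hi⟩ := h
      rw [Finset.prod_eq_zero (Finset.mem_univ i) (Set.indicator_of_notMem hi _)]
      simp
  simp_rw [e]
  have hnn : ∀ i x, 0 ≤ (s i).indicator (gaussianPDFReal 0 1) x := fun i x =>
    Set.indicator_nonneg (fun y _ => gaussianPDFReal_nonneg 0 1 y) x
  have hint : ∀ i, Integrable ((s i).indicator (gaussianPDFReal 0 1)) := fun i =>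
    (integrable_gaussianPDFReal 0 1).indicator (hs i)
  rw [← ofReal_integral_eq_lintegral_ofReal, integral_fintype_prod_volume_eq_prod
    (fun i => (s i).indicator (gaussianPDFReal 0 1)), ENNReal.ofReal_prod_of_nonneg]
  · refine Finset.prod_congr rfl fun i _ => ?_
    rw [integral_indicator (hs i), gaussianReal_apply_eq_integral _ one_ne_zero]
  · intro i _
    exact integral_nonneg (hnn i)
  · exact Integrable.fintype_prod hint
  · exact ae_of_all _ fun x => Finset.prod_nonneg fun i _ => hnn i _

lemma main_aux (m : ℕ) [NeZero m] (a : ℝ) (ha : 0 < a)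
    (K : Set (Fin m → ℝ)) (hK : MeasurableSet K)
    (hstar : ∀ x ∈ K, ∀ c : ℝ, 0 ≤ c → c ≤ 1 → c • x ∈ K) :
    _root_.stdGaussian m K * _root_.stdGaussian m {x | ∑ i, x i ^ 2 ≤ a} ≤
    _root_.stdGaussian m (K ∩ {x | ∑ i, x i ^ 2 ≤ a}) := by
  let g : ℝ → ENNReal := fun r => ENNReal.ofReal (((√(2 * Real.pi * (1 : NNReal)))⁻¹) ^ m
    * Real.exp (- r ^ 2 / 2))
  have hg : Measurable g := by fun_prop
  have hB : MeasurableSet {x : Fin m → ℝ | ∑ i, x i ^ 2 ≤ a} :=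
    measurableSet_le (by fun_prop) (by fun_prop)
  have hE : ∀ S : Set (Fin m → ℝ), MeasurableSet S → _root_.stdGaussian m S =
      ((volume : Measure (EuclideanSpace ℝ (Fin m))).withDensity fun x => g ‖x‖)
        ((WithLp.ofLp) ⁻¹' S) := by
    intro S hS
    rw [pi_density_aux, withDensity_apply _ hS, withDensity_apply _
      ((PiLp.volume_preserving_ofLp (Fin m)).measurable hS),
      ← (PiLp.volume_preserving_ofLp (Fin m)).setLIntegral_comp_preimage hS]
    · refine lintegral_congr fun x => ?_
      simp only [g, gaussianPDFReal]
      rw [Finset.prod_mul_distrib, ← Real.exp_sum, EuclideanSpace.norm_sq_eq]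
      simp [← Finset.sum_div]
    · refine ENNReal.measurable_ofReal.comp (Finset.measurable_prod _ fun i _ => ?_)
      exact (measurable_gaussianPDFReal 0 1).comp (measurable_pi_apply i)
  have hp : IsProbabilityMeasure
      ((volume : Measure (EuclideanSpace ℝ (Fin m))).withDensity fun x => g ‖x‖) := by
    constructor
    have := hE _ MeasurableSet.univ
    rw [Set.preimage_univ] at this
    rw [← this]
    unfold _root_.stdGaussian
    exact measure_univ
  have hb : (WithLp.ofLp) ⁻¹' {x : Fin m → ℝ | ∑ i, x i ^ 2 ≤ a} =
      Metric.closedBall (0 : EuclideanSpace ℝ (Fin m)) (√a) := by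
    ext x
    simp only [Set.mem_preimage, Set.mem_ofPred_eq, Metric.mem_closedBall, dist_zero_right]
    rw [EuclideanSpace.norm_eq, Real.sqrt_le_sqrt_iff ha.le]
    simp
  rw [hE _ hK, hE _ hB, hE _ (hK.inter hB), Set.preimage_inter, hb]
  refine core_aux volume g hg hp _ ((PiLp.volume_preserving_ofLp (Fin m)).measurable hK) ?_ _
  intro x hx c h0 h1
  exact hstar _ hx c h0 h1

/-- For `ε ~ N(0, I_m)` and `a > 0`, the truncated Gaussian
`ζ_{m,a} ~ ε | ε'ε ≤ a` is more peaked than `ε`: for every symmetric convex set `K ⊆ ℝ^m`,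
`P(ζ_{m,a} ∈ K) ≥ P(ε ∈ K)`. -/
theorem stmt4 (m : ℕ) (a : ℝ) (ha : 0 < a)
    (K : Set (Fin m → ℝ)) (hK : Convex ℝ K) (hsymm : K = -K) :
    stdGaussian m K ≤ (stdGaussian m)[|{x | ∑ i, x i ^ 2 ≤ a}] K := by
  have hprob : IsProbabilityMeasure (_root_.stdGaussian m) := by
    unfold _root_.stdGaussian; infer_instance
  have hB : MeasurableSet {x : Fin m → ℝ | ∑ i, x i ^ 2 ≤ a} :=
    measurableSet_le (by fun_prop) (by fun_prop)
  rcases Nat.eq_zero_or_pos m with rfl | hm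
  · have : {x : Fin 0 → ℝ | ∑ i, x i ^ 2 ≤ a} = Set.univ := by
      ext x; simp [ha.le]
    rw [this, cond_univ]
  have : NeZero m := ⟨hm.ne'⟩
  have hac : _root_.stdGaussian m ≪ volume := by
    rw [pi_density_aux]; exact withDensity_absolutelyContinuous _ _
  have hfr : _root_.stdGaussian m (frontier K) = 0 := hac (hK.addHaar_frontier volume)
  have hle : _root_.stdGaussian m K ≤ _root_.stdGaussian m (interior K) := by
    calc _ ≤ _root_.stdGaussian m (interior K ∪ frontier K) := by
          apply measure_mono
          rw [← closure_eq_interior_union_frontier]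
          exact subset_closure
      _ ≤ _ := (measure_union_le _ _).trans (by rw [hfr, add_zero])
  have hpos : _root_.stdGaussian m {x : Fin m → ℝ | ∑ i, x i ^ 2 ≤ a} ≠ 0 := by
    have hop : (gaussianReal 0 1).IsOpenPosMeasure :=
      (gaussianReal_absolutelyContinuous' 0 one_ne_zero).isOpenPosMeasure
    have hop2 : (_root_.stdGaussian m).IsOpenPosMeasure := by
      unfold _root_.stdGaussian; infer_instance
    have ho : IsOpen {x : Fin m → ℝ | ∑ i, x i ^ 2 < a} :=
      isOpen_lt (by fun_prop) (by fun_prop)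
    have h1 := ho.measure_pos (_root_.stdGaussian m) ⟨0, by simpa using ha⟩
    exact (h1.trans_le (measure_mono fun x (hx : ∑ i, x i ^ 2 < a) => show ∑ i, x i ^ 2 ≤ a from hx.le)).ne'
  have hstar : ∀ x ∈ interior K, ∀ c : ℝ, 0 ≤ c → c ≤ 1 → c • x ∈ interior K := by
    intro x hx c h0 h1
    have hneg : -x ∈ interior K := by
      have : -x ∈ -interior K := by simpa using hx
      have e : -interior K = interior (-K) := (Homeomorph.neg _).preimage_interior K
      rwa [e, ← hsymm] at this
    have := hK.interior hx hneg (a := (1 + c) / 2) (b := (1 - c) / 2) (by linarith) (by linarith)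
      (by ring)
    convert this using 1
    ext i; simp; ring
  have hmain := main_aux m a ha (interior K) isOpen_interior.measurableSet hstar
  rw [cond_apply hB]
  refine hle.trans ?_
  rw [mul_comm, ← div_eq_mul_inv, ENNReal.le_div_iff_mul_le (Or.inl hpos)
    (Or.inl (measure_ne_top _ _))]
  refine hmain.trans (measure_mono ?_)
  rw [Set.inter_comm]
  exact Set.inter_subset_inter_right _ interior_subset
end

section
/- Let ζ_{m,a} ~ D | D'D ≤ a where D ~ N(0, I_m). Then the covariance matrix of ζ_{m,a} equals v_{m,a} I_m where v_{m,a} = P(χ²_{m+2} ≤ a) / P(χ²_m ≤ a), and moreover v_{m,a} ≤ 1. -/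
open MeasureTheory ProbabilityTheory Matrix BigOperators

/-- `P(χ²_k ≤ a)`: a chi-squared variable with `k` degrees of freedom is the squared norm of a
standard Gaussian vector in `ℝ^k`. -/
noncomputable def chiSqCDF (k : ℕ) (a : ℝ) : ℝ :=
  (stdGaussian k {x | ∑ i, x i ^ 2 ≤ a}).toReal

open scoped ENNReal

noncomputable def J6 (s u : ℝ) : ℝ≥0∞ := (Set.Iic s).indicator (fun _ => (1 : ℝ≥0∞)) u

lemma J6_meas (s : ℝ) : Measurable (J6 s) :=
  measurable_const.indicator measurableSet_Iic

instance stdG6_prob (k : ℕ) : IsProbabilityMeasure (_root_.stdGaussian k) := by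
  unfold _root_.stdGaussian; infer_instance

lemma split6 (k : ℕ) (i : Fin (k+1)) (f : (Fin (k+1) → ℝ) → ℝ≥0∞) (hf : Measurable f) :
    ∫⁻ x, f x ∂(_root_.stdGaussian (k+1)) =
      ∫⁻ y, ∫⁻ t, f (i.insertNth t y) ∂(gaussianReal 0 1) ∂(_root_.stdGaussian k) := by
  have h := (measurePreserving_piFinSuccAbove (fun _ : Fin (k+1) => gaussianReal 0 1) i).symm
  unfold _root_.stdGaussian
  rw [← h.lintegral_comp hf, lintegral_prod_symm]
  · rfl
  · exact (hf.comp (MeasurableEquiv.measurable _)).aemeasurable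

lemma chi6 (k : ℕ) (s : ℝ) : _root_.stdGaussian k {x | ∑ i, x i ^ 2 ≤ s} =
    ∫⁻ x, J6 s (∑ i, x i ^ 2) ∂(_root_.stdGaussian k) := by
  have hm : MeasurableSet {x : Fin k → ℝ | ∑ i, x i ^ 2 ≤ s} :=
    measurableSet_le (by fun_prop) measurable_const
  rw [← lintegral_indicator_one hm]
  rfl

lemma gauss6 (f : ℝ → ℝ≥0∞) (hf : Measurable f) :
    ∫⁻ x, f x ∂(gaussianReal 0 1) =
      ∫⁻ x, ENNReal.ofReal ((√(2 * Real.pi))⁻¹ * Real.exp (-x^2/2)) * f x := by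
  rw [gaussianReal_of_var_ne_zero _ one_ne_zero,
    lintegral_withDensity_eq_lintegral_mul _ (measurable_gaussianPDF 0 1) hf]
  simp [gaussianPDF, gaussianPDFReal]

lemma J6_sub (s u v : ℝ) : J6 s (u + v) = J6 (s - v) u := by
  unfold J6
  by_cases h : u + v ≤ s
  · have h' : u ≤ s - v := by linarith
    simp [Set.indicator, h, h']
  · have h' : ¬ u ≤ s - v := by intro; apply h; linarith
    simp only [Set.indicator, Set.mem_Iic, h, h']

lemma dexp6 (x : ℝ) : HasDerivAt (fun r : ℝ => Real.exp (-r^2/2)) (-(x * Real.exp (-x^2/2))) x := by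
  have h : HasDerivAt (fun r : ℝ => -r^2/2) (-x) x := by
    have := ((hasDerivAt_pow 2 x).fun_neg).div_const 2
    have e : -(((2:ℕ):ℝ) * x ^ (2-1)) / 2 = -x := by norm_num; ring
    rw [← e]
    exact this
  have := h.exp
  convert this using 1
  ring

lemma radial6 (t : ℝ) (ht : 0 ≤ t) :
    ∫⁻ r in Set.Ioi (0:ℝ), ENNReal.ofReal (r * Real.exp (-r^2/2)) * J6 t (r^2) =
      ENNReal.ofReal (1 - Real.exp (-t/2)) := by
  have h1 : ∀ r ∈ Set.Ioi (0:ℝ), ENNReal.ofReal (r * Real.exp (-r^2/2)) * J6 t (r^2) =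
      (Set.Iic (√t)).indicator (fun r => ENNReal.ofReal (r * Real.exp (-r^2/2))) r := by
    intro r hr
    have : r ^ 2 ≤ t ↔ r ≤ √t := by rw [Real.le_sqrt' hr]
    simp [J6, Set.indicator, this]
  rw [setLIntegral_congr_fun measurableSet_Ioi h1, lintegral_indicator measurableSet_Iic,
    Measure.restrict_restrict measurableSet_Iic, Set.inter_comm, Set.Ioi_inter_Iic,
    ← ofReal_integral_eq_lintegral_ofReal]
  · congr 1
    rw [← intervalIntegral.integral_of_le (Real.sqrt_nonneg t),
      intervalIntegral.integral_eq_sub_of_hasDerivAt (f := fun r => - Real.exp (-r^2/2))]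
    · simp [Real.sq_sqrt ht]; ring
    · intro x _
      have := (dexp6 x).fun_neg
      rwa [neg_neg] at this
    · exact (by fun_prop : Continuous fun r : ℝ => r * Real.exp (-r^2/2)).intervalIntegrable _ _
  · exact ((by fun_prop : Continuous fun r : ℝ => r * Real.exp (-r^2/2)).integrableOn_Ioc)
  · filter_upwards [ae_restrict_mem measurableSet_Ioc] with r hr
    have := hr.1.le
    positivity

lemma two6 (t : ℝ) : ∫⁻ z, ∫⁻ w, J6 t (z^2 + w^2) ∂(gaussianReal 0 1) ∂(gaussianReal 0 1)
    = ENNReal.ofReal (1 - Real.exp (-t/2)) := by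
  rcases lt_or_ge t 0 with ht | ht
  · have : ∀ z w : ℝ, J6 t (z^2+w^2) = 0 := by
      intro z w
      have : ¬ z^2+w^2 ≤ t := by nlinarith [sq_nonneg z, sq_nonneg w]
      simp only [J6, Set.indicator, Set.mem_Iic, this]; simp
    simp only [this, lintegral_zero]
    symm
    rw [ENNReal.ofReal_eq_zero, sub_nonpos, Real.one_le_exp_iff]
    linarith
  have hJ := J6_meas t
  have hm : Measurable fun p : ℝ × ℝ => J6 t (p.1^2+p.2^2) := hJ.comp (by fun_prop)
  rw [gauss6 _ hm.lintegral_prod_right']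
  have h1 : ∀ z : ℝ, ∫⁻ w, J6 t (z^2 + w^2) ∂(gaussianReal 0 1) = _ := fun z => gauss6 _ (hJ.comp (by fun_prop))
  simp only [h1]
  have h2 : ∀ z : ℝ, ENNReal.ofReal ((√(2 * Real.pi))⁻¹ * Real.exp (-z^2/2)) *
      ∫⁻ w, ENNReal.ofReal ((√(2 * Real.pi))⁻¹ * Real.exp (-w^2/2)) * J6 t (z^2+w^2) =
      ∫⁻ w, ENNReal.ofReal ((2*Real.pi)⁻¹ * Real.exp (-(z^2+w^2)/2)) * J6 t (z^2+w^2) := by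
    intro z
    rw [← lintegral_const_mul]
    · congr 1; ext w
      rw [← mul_assoc, ← ENNReal.ofReal_mul (by positivity)]
      congr 2
      have : Real.exp (-(z^2+w^2)/2) = Real.exp (-z^2/2) * Real.exp (-w^2/2) := by
        rw [← Real.exp_add]; ring_nf
      rw [this]
      have h3 : (2*Real.pi)⁻¹ = (√(2 * Real.pi))⁻¹ * (√(2 * Real.pi))⁻¹ := by
        rw [← mul_inv, Real.mul_self_sqrt (by positivity)]
      rw [h3]; ring
    · exact (by fun_prop : Measurable _).mul (hJ.comp (by fun_prop))
  simp only [h2]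
  rw [← lintegral_prod (fun p : ℝ × ℝ => ENNReal.ofReal ((2*Real.pi)⁻¹ * Real.exp (-(p.1^2+p.2^2)/2)) * J6 t (p.1^2+p.2^2)) ((by fun_prop : Measurable _).mul hm).aemeasurable]
  change ∫⁻ p : ℝ × ℝ, _ = _
  rw [← lintegral_comp_polarCoord_symm]
  have h4 : ∀ p : ℝ × ℝ, p ∈ polarCoord.target → ENNReal.ofReal p.1 • (ENNReal.ofReal ((2*Real.pi)⁻¹ *
      Real.exp (-((polarCoord.symm p).1^2+(polarCoord.symm p).2^2)/2)) *
        J6 t ((polarCoord.symm p).1^2+(polarCoord.symm p).2^2)) =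
      (ENNReal.ofReal (p.1 * Real.exp (-p.1^2/2)) * J6 t (p.1^2)) * ENNReal.ofReal ((2*Real.pi)⁻¹) := by
    intro p hp
    have h0 : 0 < p.1 := hp.1
    have : (polarCoord.symm p).1^2+(polarCoord.symm p).2^2 = p.1^2 := by
      simp only [polarCoord_symm_apply]
      nlinarith [Real.sin_sq_add_cos_sq p.2]
    rw [this, ENNReal.ofReal_mul (by positivity), ENNReal.ofReal_mul h0.le, smul_eq_mul]
    ring
  rw [setLIntegral_congr_fun polarCoord.open_target.measurableSet h4, polarCoord_target,
    Measure.volume_eq_prod, ← Measure.prod_restrict, lintegral_prod_mul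
      (f := fun r => ENNReal.ofReal (r * Real.exp (-r^2/2)) * J6 t (r^2))
      (g := fun _ => ENNReal.ofReal ((2*Real.pi)⁻¹)), radial6 t ht]
  · rw [lintegral_const, Measure.restrict_apply_univ, Real.volume_Ioo,
      ← ENNReal.ofReal_mul (by positivity)]
    have : (2*Real.pi)⁻¹ * (Real.pi - -Real.pi) = 1 := by
      have := Real.pi_ne_zero
      field_simp; ring
    rw [this]; simp
  · exact ((by fun_prop : Measurable _).mul (hJ.comp (by fun_prop))).aemeasurable
  · fun_prop

lemma one6 (s : ℝ) : ∫⁻ x, ENNReal.ofReal (1 - Real.exp (-(s-x^2)/2)) ∂(gaussianReal 0 1) =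
    ∫⁻ x, J6 s (x^2) * ENNReal.ofReal (x^2) ∂(gaussianReal 0 1) := by
  have hJ := J6_meas s
  rcases lt_or_ge s 0 with ht | ht
  · congr 1; ext x
    have : ¬ x^2 ≤ s := by nlinarith [sq_nonneg x]
    simp only [J6, Set.indicator, Set.mem_Iic, this]
    simp only [if_false, zero_mul]
    rw [ENNReal.ofReal_eq_zero, sub_nonpos, Real.one_le_exp_iff]
    linarith
  rw [gauss6 _ (by fun_prop), gauss6 (fun x => J6 s (x^2) * ENNReal.ofReal (x^2))
    ((hJ.comp (by fun_prop)).mul (by fun_prop))]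
  set c := (√(2 * Real.pi))⁻¹ with hc
  have hc0 : 0 ≤ c := by positivity
  have key : ∀ x : ℝ, x^2 ≤ s ↔ x ∈ Set.Icc (-√s) (√s) := by
    intro x; rw [Set.mem_Icc, ← Real.sq_le ht]
  have e1 : ∀ x : ℝ, ENNReal.ofReal (c * Real.exp (-x^2/2)) * ENNReal.ofReal (1 - Real.exp (-(s-x^2)/2))
      = (Set.Icc (-√s) (√s)).indicator (fun x => ENNReal.ofReal (c * Real.exp (-x^2/2) - c * Real.exp (-s/2))) x := by
    intro x
    have : c * Real.exp (-x^2/2) - c * Real.exp (-s/2) = c * Real.exp (-x^2/2) * (1 - Real.exp (-(s-x^2)/2)) := by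
      have : Real.exp (-s/2) = Real.exp (-x^2/2) * Real.exp (-(s-x^2)/2) := by
        rw [← Real.exp_add]; ring_nf
      rw [this]; ring
    simp only [Set.indicator, ← key, this]
    split_ifs with h
    · rw [ENNReal.ofReal_mul (p := c * Real.exp (-x^2/2)) (by positivity)]
    · rw [mul_eq_zero]; right
      rw [ENNReal.ofReal_eq_zero, sub_nonpos, Real.one_le_exp_iff]
      linarith
  have e2 : ∀ x : ℝ, ENNReal.ofReal (c * Real.exp (-x^2/2)) * (J6 s (x^2) * ENNReal.ofReal (x^2))
      = (Set.Icc (-√s) (√s)).indicator (fun x => ENNReal.ofReal (c * Real.exp (-x^2/2) * x^2)) x := by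
    intro x
    simp only [J6, Set.indicator, ← key, Set.mem_Iic]
    split_ifs with h
    · rw [ENNReal.ofReal_mul (p := c * Real.exp (-x^2/2)) (by positivity), one_mul]
    · simp
  simp only [e1, e2]
  rw [lintegral_indicator measurableSet_Icc, lintegral_indicator measurableSet_Icc,
    ← ofReal_integral_eq_lintegral_ofReal, ← ofReal_integral_eq_lintegral_ofReal]
  · congr 1
    have hle : -√s ≤ √s := by linarith [Real.sqrt_nonneg s]
    rw [integral_Icc_eq_integral_Ioc, integral_Icc_eq_integral_Ioc,
      ← intervalIntegral.integral_of_le hle, ← intervalIntegral.integral_of_le hle,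
      ← sub_eq_zero, ← intervalIntegral.integral_sub,
      intervalIntegral.integral_eq_sub_of_hasDerivAt
        (f := fun x => c * (x * Real.exp (-x^2/2)) - c * Real.exp (-s/2) * x)]
    · simp [Real.sq_sqrt ht]; ring
    · intro x _
      have := (((hasDerivAt_id' x).fun_mul (dexp6 x)).const_mul c).fun_sub
        ((hasDerivAt_id' x).const_mul (c * Real.exp (-s/2)))
      convert this using 1
      ring
    all_goals exact Continuous.intervalIntegrable (by fun_prop) _ _
  · exact Continuous.integrableOn_Icc (by fun_prop)
  · filter_upwards with x
    positivity
  · exact Continuous.integrableOn_Icc (by fun_prop)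
  · filter_upwards [ae_restrict_mem measurableSet_Icc] with x hx
    have : x^2 ≤ s := (key x).2 hx
    have : Real.exp (-s/2) ≤ Real.exp (-x^2/2) := by
      apply Real.exp_le_exp.2; linarith
    simp only [Pi.zero_apply]
    nlinarith

lemma peel6 (k : ℕ) (f : ℝ → ℝ≥0∞) (hf : Measurable f) :
    ∫⁻ x, f (∑ i, x i ^ 2) ∂(_root_.stdGaussian (k+1)) =
      ∫⁻ y, ∫⁻ t, f (t^2 + ∑ i, y i ^ 2) ∂(gaussianReal 0 1) ∂(_root_.stdGaussian k) := by
  rw [split6 k 0 (fun x => f (∑ i, x i ^ 2)) (hf.comp (by fun_prop))]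
  simp [Fin.sum_univ_succ]

lemma peelm6 (f : ℝ → ℝ≥0∞) (hf : Measurable f) :
    Measurable fun u => ∫⁻ t, f (t^2 + u) ∂(gaussianReal 0 1) := by
  have : Measurable fun p : ℝ × ℝ => f (p.2^2 + p.1) := hf.comp (by fun_prop)
  exact this.lintegral_prod_right'

lemma two6' (k : ℕ) (s : ℝ) : ∫⁻ x, J6 s (∑ i, x i ^ 2) ∂(_root_.stdGaussian (k+2)) =
    ∫⁻ y, ENNReal.ofReal (1 - Real.exp (-(s - ∑ i, y i ^ 2)/2)) ∂(_root_.stdGaussian k) := by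
  rw [peel6 _ _ (J6_meas s), peel6 k _ (peelm6 _ (J6_meas s))]
  congr 1; ext y
  rw [← two6]
  congr 1; ext z; congr 1; ext w
  rw [← J6_sub]; congr 1; ring

lemma diag6 (m : ℕ) (i : Fin m) (s : ℝ) :
    ∫⁻ x, J6 s (∑ i, x i ^ 2) * ENNReal.ofReal (x i ^ 2) ∂(_root_.stdGaussian m) =
      ∫⁻ x, J6 s (∑ i, x i ^ 2) ∂(_root_.stdGaussian (m+2)) := by
  obtain _ | n := m
  · exact i.elim0
  have hJ := J6_meas s
  rw [split6 n i (fun x => J6 s (∑ i, x i ^ 2) * ENNReal.ofReal (x i ^ 2)) ((hJ.comp (by fun_prop)).mul (by fun_prop)), two6',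
    peel6 n (fun u => ENNReal.ofReal (1 - Real.exp (-(s - u)/2))) (by fun_prop)]
  congr 1; ext y
  have := one6 (s - ∑ i, y i ^ 2)
  have h2 : ∀ t : ℝ, s - (t^2 + ∑ i, y i ^ 2) = s - ∑ i, y i ^ 2 - t^2 := fun t => by ring
  simp only [h2, this]
  congr 1; ext t
  rw [Fin.sum_univ_succAbove _ i]
  simp [J6_sub]

lemma mono6 (m : ℕ) (s : ℝ) : ∫⁻ x, J6 s (∑ i, x i ^ 2) ∂(_root_.stdGaussian (m+2)) ≤
    ∫⁻ x, J6 s (∑ i, x i ^ 2) ∂(_root_.stdGaussian m) := by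
  rw [two6']
  apply lintegral_mono
  intro y
  simp only [J6, Set.indicator, Set.mem_Iic]
  split_ifs with h
  · rw [← ENNReal.ofReal_one]
    apply ENNReal.ofReal_le_ofReal
    linarith [Real.exp_pos (-(s - ∑ i, y i ^ 2)/2)]
  · rw [nonpos_iff_eq_zero, ENNReal.ofReal_eq_zero, sub_nonpos, Real.one_le_exp_iff]
    linarith

lemma flip6 (m : ℕ) (i : Fin m) (a : ℝ) (f : (Fin m → ℝ) → ℝ)
    (hf : ∀ x : Fin m → ℝ, f (fun j => if j = i then - x j else x j) = - f x) :
    ∫ x in {x | ∑ i, x i ^ 2 ≤ a}, f x ∂(_root_.stdGaussian m) = 0 := by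
  let g : Fin m → ℝ → ℝ := fun j t => if j = i then -t else t
  have hmp : MeasurePreserving (fun (x : Fin m → ℝ) j => g j (x j)) (_root_.stdGaussian m)
      (_root_.stdGaussian m) := by
    apply measurePreserving_pi
    intro j
    by_cases h : j = i
    · simp only [g, h, if_true]
      exact ⟨measurable_neg, by simpa using gaussianReal_map_neg (μ := 0) (v := 1)⟩
    · simp only [g, h, if_false]
      exact MeasurePreserving.id _
  have hinv : Function.Involutive (fun (x : Fin m → ℝ) j => g j (x j)) := by
    intro x; ext j; simp only [g]; split_ifs <;> simp
  have hemb : MeasurableEmbedding (fun (x : Fin m → ℝ) j => g j (x j)) :=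
    (MeasurableEquiv.mk hinv.toPerm hmp.measurable hmp.measurable).measurableEmbedding
  have := hmp.setIntegral_preimage_emb hemb f {x | ∑ i, x i ^ 2 ≤ a}
  have hpre : (fun (x : Fin m → ℝ) j => g j (x j)) ⁻¹' {x | ∑ i, x i ^ 2 ≤ a} = {x | ∑ i, x i ^ 2 ≤ a} := by
    ext x
    have : ∀ j, (g j (x j))^2 = x j ^ 2 := by
      intro j; simp only [g]; split_ifs <;> simp
    simp [this]
  rw [hpre] at this
  have h3 : ∀ x : Fin m → ℝ, f (fun j => g j (x j)) = - f x := hf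
  simp only [h3, integral_neg] at this
  linarith

theorem stmt6 (m : ℕ) (a : ℝ) (ha : 0 < a) :
    letI ζ := (stdGaussian m)[|{x | ∑ i, x i ^ 2 ≤ a}]
    letI v : ℝ := chiSqCDF (m + 2) a / chiSqCDF m a
    ((Matrix.of fun i j => (∫ x, x i * x j ∂ζ) - (∫ x, x i ∂ζ) * (∫ x, x j ∂ζ))
        = v • (1 : Matrix (Fin m) (Fin m) ℝ)) ∧ v ≤ 1 := by
  set ζ := (_root_.stdGaussian m)[|{x | ∑ i, x i ^ 2 ≤ a}] with hζdef
  set v : ℝ := chiSqCDF (m + 2) a / chiSqCDF m a with hv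
  have hm : MeasurableSet {x : Fin m → ℝ | ∑ i, x i ^ 2 ≤ a} :=
    measurableSet_le (by fun_prop) measurable_const
  have hζ : ∀ f : (Fin m → ℝ) → ℝ, ∫ x, f x ∂ζ = (chiSqCDF m a)⁻¹ *
      ∫ x in {x | ∑ i, x i ^ 2 ≤ a}, f x ∂(_root_.stdGaussian m) := by
    intro f
    simp only [hζdef, ProbabilityTheory.cond, integral_smul_measure, chiSqCDF, ENNReal.toReal_inv,
      smul_eq_mul]
  constructor
  · ext i j
    have h0 : ∫ x, x i ∂ζ = 0 := by
      rw [hζ, flip6 m i a (fun x => x i) (by simp), mul_zero]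
    simp only [Matrix.of_apply, Matrix.smul_apply, h0, zero_mul, sub_zero, smul_eq_mul]
    by_cases hij : i = j
    · subst hij
      rw [Matrix.one_apply_eq, mul_one, hζ, integral_eq_lintegral_of_nonneg_ae]
      · simp only [hv, div_eq_inv_mul]
        congr 1
        rw [chiSqCDF, chi6, ← diag6 m i, ← lintegral_indicator hm]
        congr 2; ext x
        simp [J6, Set.indicator, pow_two]
      · filter_upwards with x
        exact mul_self_nonneg _
      · exact (by fun_prop : Measurable fun x : Fin m → ℝ => x i * x i).aestronglyMeasurable
    · rw [Matrix.one_apply_ne hij, mul_zero, hζ, flip6 m i a, mul_zero]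
      intro x
      simp [Ne.symm hij]
  · apply div_le_one_of_le₀ _ ENNReal.toReal_nonneg
    apply ENNReal.toReal_mono (measure_ne_top _ _)
    rw [chi6, chi6]
    exact mono6 m a
end

section
/- If a random vector ψ ∈ ℝ^m is central convex unimodal, then for any matrix C ∈ ℝ^{p×m} (not necessarily of full rank), the random vector Cψ ∈ ℝ^p is central convex unimodal. -/
open MeasureTheory ProbabilityTheory Matrix BigOperators NNReal ENNReal

/-- Weak convergence of a sequence of measures to a measure: convergence of integrals of all
bounded continuous functions. -/
def WeakLimit {E : Type*} [TopologicalSpace E] [MeasurableSpace E]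
    (μs : ℕ → Measure E) (μ : Measure E) : Prop :=
  ∀ f : BoundedContinuousFunction E ℝ,
    Filter.Tendsto (fun n => ∫ x, f x ∂(μs n)) Filter.atTop (nhds (∫ x, f x ∂μ))

/-- A set of measures is closed convex if it is closed under convex mixtures and under weak
sequential limits (of probability measures). -/
def IsClosedConvexMeasureSet {E : Type*} [TopologicalSpace E] [MeasurableSpace E]
    (B : Set (Measure E)) : Prop :=
  (∀ μ ∈ B, ∀ ν ∈ B, ∀ t : ℝ≥0∞, t ≤ 1 → t • μ + (1 - t) • ν ∈ B) ∧
  (∀ μs : ℕ → Measure E, (∀ n, μs n ∈ B) →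
    ∀ μ : Measure E, IsProbabilityMeasure μ → WeakLimit μs μ → μ ∈ B)

/-- The set of uniform distributions on symmetric convex bodies of `ℝ^m` (compact convex sets
with nonempty interior, symmetric about the origin). -/
def uniformBodies (m : ℕ) : Set (Measure (Fin m → ℝ)) :=
  {μ | ∃ K : Set (Fin m → ℝ), IsCompact K ∧ Convex ℝ K ∧ (interior K).Nonempty ∧
        K = -K ∧ μ = (volume : Measure (Fin m → ℝ))[|K]}

/-- A distribution on `ℝ^m` is central convex unimodal if it belongs to the closed convex hull
of the uniform distributions on symmetric convex bodies, i.e. to every closed convex set of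
measures containing them. -/
def IsCCU {m : ℕ} (μ : Measure (Fin m → ℝ)) : Prop :=
  ∀ B : Set (Measure (Fin m → ℝ)), IsClosedConvexMeasureSet B → uniformBodies m ⊆ B → μ ∈ B

/-- Sherman's peakedness ordering: `μ` is more peaked than `ν` if `μ K ≥ ν K` for every
symmetric convex set `K`. -/
def MorePeaked {m : ℕ} (μ ν : Measure (Fin m → ℝ)) : Prop :=
  ∀ K : Set (Fin m → ℝ), Convex ℝ K → K = -K → ν K ≤ μ K


section
set_option linter.unusedSectionVars false
variable {E F : Type*} [NormedAddCommGroup E] [NormedSpace ℝ E] [MeasureSpace E] [BorelSpace E]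
  [NormedAddCommGroup F] [NormedSpace ℝ F] [MeasureSpace F] [BorelSpace F]

def UB (E : Type*) [NormedAddCommGroup E] [NormedSpace ℝ E] [MeasureSpace E] : Set (Measure E) :=
  {μ | ∃ K : Set E, IsCompact K ∧ Convex ℝ K ∧ (interior K).Nonempty ∧
        K = -K ∧ μ = (volume : Measure E)[|K]}

def CCU (μ : Measure E) : Prop :=
  ∀ B : Set (Measure E), IsClosedConvexMeasureSet B → UB E ⊆ B → μ ∈ B

lemma ccu_of_ub {μ : Measure E} (h : μ ∈ UB E) : CCU μ := fun _ _ hU => hU h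

lemma ccu_push (f : E →L[ℝ] F) (h : ∀ ν ∈ UB E, CCU (ν.map f)) (μ : Measure E) (hμ : CCU μ) :
    CCU (μ.map f) := by
  intro B hB hU
  refine hμ {ν | ν.map f ∈ B} ⟨?_, ?_⟩ (fun ν hν => h ν hν B hB hU)
  · intro μ hμ ν hν t ht
    have := hB.1 _ hμ _ hν t ht
    simp only [Set.mem_ofPred_eq]
    rw [Measure.map_add _ _ f.continuous.measurable, Measure.map_smul, Measure.map_smul]
    exact this
  · intro μs hμs μ hp hl
    refine hB.2 _ hμs _ (Measure.isProbabilityMeasure_map f.continuous.measurable.aemeasurable) ?_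
    intro g
    have := hl (g.compContinuous ⟨f, f.continuous⟩)
    have key : ∀ ν : Measure E, ∫ x, g x ∂(ν.map f) = ∫ x, g (f x) ∂ν := fun ν =>
      integral_map_of_stronglyMeasurable f.continuous.measurable g.continuous.measurable.stronglyMeasurable
    simpa [key] using this

lemma ub_equiv [FiniteDimensional ℝ E] [FiniteDimensional ℝ F]
    [(volume : Measure E).IsAddHaarMeasure] [(volume : Measure F).IsAddHaarMeasure]
    (e : E ≃L[ℝ] F) (ν : Measure E) (hν : ν ∈ UB E) : ν.map e ∈ UB F := by
  obtain ⟨K, hK, hc, hi, hs, rfl⟩ := hν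
  refine ⟨e '' K, hK.image e.continuous, hc.linear_image e.toLinearMap, ?_, ?_, ?_⟩
  · have : e '' interior K = interior (e '' K) := e.toHomeomorph.image_interior K
    rw [← this]; exact hi.image _
  · conv_lhs => rw [hs]
    ext y; constructor
    · rintro ⟨x, hx, rfl⟩
      exact ⟨-x, hx, by simp⟩
    · rintro ⟨x, hx, h⟩
      exact ⟨-x, by simpa using hx, by simp [h]⟩
  · have hh : ((volume : Measure E).map e).IsAddHaarMeasure := e.isAddHaarMeasure_map _
    have h1 := Measure.isAddLeftInvariant_eq_smul ((volume : Measure E).map e) (volume : Measure F)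
    set c := Measure.addHaarScalarFactor ((volume : Measure E).map e) (volume : Measure F) with hcdef
    have hc0 : c ≠ 0 := by
      have := Measure.addHaarScalarFactor_pos_of_isAddHaarMeasure ((volume : Measure E).map e) (volume : Measure F)
      exact this.ne'
    have hme : MeasurableEmbedding e := e.toHomeomorph.measurableEmbedding
    have hpre : e ⁻¹' (e '' K) = K := Set.preimage_image_eq _ e.injective
    have h2 : volume K = c * volume (e '' K) := by
      have := congrArg (fun m => m (e '' K)) h1
      simp only [Measure.smul_apply] at this
      rw [hme.map_apply, hpre] at this
      rw [this]; rfl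
    have h3 : ((volume : Measure E).restrict K).map e = c • (volume : Measure F).restrict (e '' K) := by
      rw [← hpre, ← hme.restrict_map, h1, hpre, Measure.restrict_smul]
    unfold ProbabilityTheory.cond
    rw [Measure.map_smul, h3, h2, ENNReal.mul_inv (Or.inl (by simpa using hc0)) (Or.inl (by simp))]
    ext s hs
    simp only [Measure.smul_apply, smul_eq_mul, ENNReal.smul_def]
    have hc1 : (c : ℝ≥0∞) ≠ 0 := by simpa using hc0
    rw [mul_comm (c : ℝ≥0∞)⁻¹, mul_assoc, ← mul_assoc (c : ℝ≥0∞)⁻¹,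
      ENNReal.inv_mul_cancel hc1 (by simp), one_mul]

lemma ccu_equiv [FiniteDimensional ℝ E] [FiniteDimensional ℝ F]
    [(volume : Measure E).IsAddHaarMeasure] [(volume : Measure F).IsAddHaarMeasure]
    (e : E ≃L[ℝ] F) (μ : Measure E) (hμ : CCU μ) : CCU (μ.map e) :=
  ccu_push (e : E →L[ℝ] F) (fun ν hν => ccu_of_ub (ub_equiv e ν hν)) μ hμ

/-- finite mixtures -/
lemma mix_mem {B : Set (Measure E)} (hB : IsClosedConvexMeasureSet B) (A : ℕ → Set E)
    (n : ℕ) (h0 : ∀ k ≤ n, volume (A k) ≠ 0) (ht : ∀ k ≤ n, volume (A k) ≠ ∞)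
    (hm : ∀ k ≤ n, (volume : Measure E)[|A k] ∈ B) :
    (∑ k ∈ Finset.range (n+1), volume (A k))⁻¹ •
      ∑ k ∈ Finset.range (n+1), (volume : Measure E).restrict (A k) ∈ B := by
  induction n with
  | zero => simpa [ProbabilityTheory.cond] using hm 0 le_rfl
  | succ n ih =>
    have ih := ih (fun k hk => h0 k (by lia)) (fun k hk => ht k (by lia)) (fun k hk => hm k (by lia))
    rw [Finset.sum_range_succ, Finset.sum_range_succ _ (n+1)]
    set S := ∑ k ∈ Finset.range (n+1), volume (A k) with hS
    set T := ∑ k ∈ Finset.range (n+1), (volume : Measure E).restrict (A k)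
    have hS0 : S ≠ 0 := by
      rw [hS, Finset.sum_range_succ]
      simp [h0 n (by lia)]
    have hSt : S ≠ ∞ := by
      rw [hS]
      exact ENNReal.sum_ne_top.2 (fun k hk => ht k (by have := Finset.mem_range.1 hk; lia))
    have w0 := h0 (n+1) le_rfl
    have wt := ht (n+1) le_rfl
    have hw := hm (n+1) le_rfl
    set w := volume (A (n+1))
    have hsum : S + w ≠ 0 := by simp [hS0]
    have hsumt : S + w ≠ ∞ := by simp [hSt, wt]
    have := hB.1 _ ih _ hw (S / (S + w)) (ENNReal.div_le_of_le_mul (by simp))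
    have e1 : 1 - S / (S + w) = w / (S+w) := by
      have : S / (S+w) + w / (S+w) = 1 := by
        rw [← ENNReal.add_div, ENNReal.div_self hsum hsumt]
      rw [← this, ENNReal.add_sub_cancel_left]
      exact (ENNReal.div_lt_top hSt hsum).ne
    rw [e1] at this
    convert this using 1
    unfold ProbabilityTheory.cond
    rw [smul_smul, smul_smul, smul_add]
    congr 2
    · rw [div_eq_mul_inv, mul_right_comm, ENNReal.mul_inv_cancel hS0 hSt, one_mul]
    · rw [div_eq_mul_inv, mul_right_comm, ENNReal.mul_inv_cancel w0 wt, one_mul]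

end

section
set_option linter.unusedSectionVars false
variable {E : Type*} [NormedAddCommGroup E] [NormedSpace ℝ E] [MeasureSpace E] [BorelSpace E]

def lev (K : Set (E × ℝ)) (s : ℝ) : Set E := {x | ∃ y, (x, y) ∈ K ∧ (x, y + s) ∈ K}

lemma lev_compact {K : Set (E × ℝ)} (hK : IsCompact K) (s : ℝ) : IsCompact (lev K s) := by
  have : lev K s = Prod.fst '' (K ∩ (fun q : E × ℝ => (q.1, q.2 + s)) ⁻¹' K) := by
    ext x
    constructor
    · rintro ⟨y, h1, h2⟩; exact ⟨(x, y), ⟨h1, h2⟩, rfl⟩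
    · rintro ⟨⟨x, y⟩, ⟨h1, h2⟩, rfl⟩; exact ⟨y, h1, h2⟩
  rw [this]
  refine (hK.inter_right (hK.isClosed.preimage (by fun_prop))).image continuous_fst

lemma lev_convex {K : Set (E × ℝ)} (hK : Convex ℝ K) (s : ℝ) : Convex ℝ (lev K s) := by
  rintro x ⟨y, h1, h2⟩ x' ⟨y', h1', h2'⟩ a b ha hb hab
  refine ⟨a * y + b * y', ?_, ?_⟩
  · exact hK h1 h1' ha hb hab
  · have := hK h2 h2' ha hb hab
    convert this using 1
    ext
    · rfl
    · simp only [Prod.snd_add, Prod.smul_snd, smul_eq_mul]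
      linear_combination (-s) * hab

lemma lev_neg {K : Set (E × ℝ)} (hK : K = -K) (s : ℝ) : lev K s = -lev K s := by
  have hn : ∀ q : E × ℝ, q ∈ K → -q ∈ K := fun q hq => by rw [hK] at hq; exact hq
  have : ∀ x ∈ lev K s, -x ∈ lev K s := by
    rintro x ⟨y, h1, h2⟩
    refine ⟨-(y+s), hn _ h2, ?_⟩
    have := hn _ h1
    convert this using 1
    ext
    · rfl
    · simp
  ext x
  constructor
  · exact this x
  · intro h; simpa using this _ h

lemma lev_zero {K : Set (E × ℝ)} {s x} (hK : K = -K) (hc : Convex ℝ K) (h : x ∈ lev K s) :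
    ((0 : E), s / 2) ∈ K := by
  have hn : ∀ q : E × ℝ, q ∈ K → -q ∈ K := fun q hq => by rw [hK] at hq; exact hq
  obtain ⟨y, h1, h2⟩ := h
  have := hc h2 (hn _ h1) (a := 1/2) (b := 1/2) (by norm_num) (by norm_num) (by norm_num)
  convert this using 1
  ext
  · simp
  · simp; ring

lemma zero_int {G : Type*} [NormedAddCommGroup G] [NormedSpace ℝ G] {K : Set G} (hK : K = -K)
    (hc : Convex ℝ K) (hi : (interior K).Nonempty) : (0 : G) ∈ interior K := by
  obtain ⟨x, hx⟩ := hi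
  have h2 : -x ∈ interior K := by
    have : Homeomorph.neg G '' interior K = interior (Homeomorph.neg G '' K) :=
      (Homeomorph.neg G).image_interior K
    have h3 : Homeomorph.neg G '' K = K := by
      conv_rhs => rw [hK]
      ext y; simp
    rw [h3] at this
    rw [← this]
    exact ⟨x, hx, rfl⟩
  have := hc.interior hx h2 (a := 1/2) (b := 1/2) (by norm_num) (by norm_num) (by norm_num)
  simpa using this

lemma lev_int {K : Set (E × ℝ)} (hK : K = -K) (hc : Convex ℝ K) (hi : (interior K).Nonempty)
    {R s : ℝ} (hR : ((0 : E), R) ∈ K) (h0 : 0 ≤ s) (hs : s < 2 * R) :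
    (interior (lev K s)).Nonempty := by
  have hn : ∀ q : E × ℝ, q ∈ K → -q ∈ K := fun q hq => by rw [hK] at hq; exact hq
  have h00 := zero_int hK hc hi
  refine ⟨0, ?_⟩
  set l := s / (2 * R)
  have hR0 : 0 < 2 * R := by linarith
  have hl0 : 0 ≤ l := by positivity
  have hl1 : l < 1 := (div_lt_one hR0).2 hs
  have hlR : l * R = s / 2 := by
    have hR1 : R ≠ 0 := by intro h; simp [h] at hR0
    simp only [l]; field_simp
  have hcont : Filter.Tendsto (fun x : E => (((1 - l)⁻¹ • x, (0:ℝ)) : E × ℝ)) (nhds 0) (nhds 0) := by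
    have : Continuous (fun x : E => (((1 - l)⁻¹ • x, (0:ℝ)) : E × ℝ)) := by fun_prop
    have h := this.tendsto 0
    simp only [smul_zero] at h
    exact h
  rw [mem_interior_iff_mem_nhds]
  filter_upwards [hcont (mem_interior_iff_mem_nhds.1 h00)] with x hx
  have hx : ((1 - l)⁻¹ • x, (0:ℝ)) ∈ K := hx
  have h1 := hc hx hR (a := 1 - l) (b := l) (by linarith) hl0 (by ring)
  have h2 := hc hx (hn _ hR) (a := 1 - l) (b := l) (by linarith) hl0 (by ring)
  have hne : 1 - l ≠ 0 := by linarith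
  refine ⟨-(s/2), ?_, ?_⟩
  · convert h2 using 1
    ext
    · simp [smul_smul, hne]
    · simp [hlR]
  · convert h1 using 1
    ext
    · simp [smul_smul, hne]
    · simp [hlR]; ring

/-- fibre length -/
noncomputable def flen (K : Set (E × ℝ)) (x : E) : ℝ := (volume : Measure ℝ).real {y | (x, y) ∈ K}

lemma mem_lev_iff {K : Set (E × ℝ)} (hK : IsCompact K) (hc : Convex ℝ K) {s : ℝ} (h0 : 0 ≤ s)
    {x : E} (hx : x ∈ lev K 0) : x ∈ lev K s ↔ s ≤ flen K x := by
  have hcl : Topology.IsClosedEmbedding (fun y : ℝ => (x, y)) := by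
    exact Topology.IsClosedEmbedding.of_continuous_injective_isClosedMap (by fun_prop)
      (fun a b h => (Prod.ext_iff.1 h).2) (isClosedMap_prodMk_left x)
  have hcomp : IsCompact {y | (x, y) ∈ K} := hcl.isCompact_preimage hK
  have hconv : Convex ℝ {y | (x, y) ∈ K} := by
    intro y h1 y' h1' a b ha hb hab
    have := hc h1 h1' ha hb hab
    simpa [← add_smul, hab] using this
  obtain ⟨y0, hy0, -⟩ := hx
  have hIcc := eq_Icc_of_connected_compact ⟨⟨y0, hy0⟩, hconv.isPreconnected⟩ hcomp
  set a := sInf {y | (x, y) ∈ K}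
  set b := sSup {y | (x, y) ∈ K}
  have hm : ∀ y, (x, y) ∈ K ↔ a ≤ y ∧ y ≤ b := fun y => by
    have : y ∈ {y | (x, y) ∈ K} ↔ y ∈ Set.Icc a b := by rw [hIcc]
    exact this
  have hab : a ≤ b := by have := (hm y0).1 hy0; linarith
  have hf : flen K x = b - a := by
    unfold flen; rw [hIcc, Real.volume_real_Icc_of_le hab]
  rw [hf]
  constructor
  · rintro ⟨y, h1, h2⟩
    rw [hm] at h1 h2; linarith
  · intro h
    refine ⟨a, (hm _).2 ⟨le_rfl, hab⟩, (hm _).2 ⟨by linarith, by linarith⟩⟩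

lemma flen_zero {K : Set (E × ℝ)} {x : E} (hx : x ∉ lev K 0) : flen K x = 0 := by
  have : {y | (x, y) ∈ K} = ∅ := by
    ext y
    simp only [Set.mem_ofPred_eq, Set.mem_empty_iff_false, iff_false]
    intro h; exact hx ⟨y, h, by simpa using h⟩
  simp [flen, this]

lemma count_lim {L g : ℝ} (hL : 0 < L) (h0 : 0 ≤ g) (hg : g ≤ L) :
    Filter.Tendsto (fun n : ℕ => L / (n+1) * ∑ k ∈ Finset.range (n+1),
      if (k : ℝ) * L / (n + 1) ≤ g then (1:ℝ) else 0) Filter.atTop (nhds g) := by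
  have hu : Filter.Tendsto (fun n : ℕ => g + L / ((n:ℝ)+1)) Filter.atTop (nhds g) := by
    have := (tendsto_one_div_add_atTop_nhds_zero_nat (𝕜 := ℝ)).const_mul L
    simpa [div_eq_mul_inv] using this.const_add g
  refine tendsto_of_tendsto_of_tendsto_of_le_of_le tendsto_const_nhds hu ?_ ?_
  all_goals
    intro n
    have hn : (0:ℝ) < n + 1 := by positivity
    simp only []
    rw [Finset.sum_boole]
    have e : ∀ k : ℕ, (k : ℝ) * L / (n + 1) ≤ g ↔ k ≤ ⌊g * (n+1) / L⌋₊ := by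
      intro k
      rw [Nat.le_floor_iff (by positivity), div_le_iff₀ hn, le_div_iff₀ hL]
    have hcard : (Finset.range (n+1)).filter (fun k : ℕ => (k : ℝ) * L / (n + 1) ≤ g)
        = Finset.range (min (n+1) (⌊g * (n+1) / L⌋₊ + 1)) := by
      ext k; simp only [Finset.mem_filter, Finset.mem_range, e]; lia
    rw [hcard, Finset.card_range]
    have f1 := Nat.lt_floor_add_one (g * (n+1) / L)
    have f2 := Nat.floor_le (show 0 ≤ g * (n+1) / L by positivity)
    set q := ⌊g * (n+1) / L⌋₊
    rw [div_lt_iff₀ hL] at f1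
    rw [le_div_iff₀ hL] at f2
    rw [div_mul_eq_mul_div]
  · rw [le_div_iff₀ hn]
    push_cast
    rcases min_cases ((n:ℝ)+1) ((q:ℝ)+1) with ⟨h, _⟩ | ⟨h, _⟩ <;> rw [h]
    · gcongr
    · linarith
  · rw [div_le_iff₀ hn, add_mul, div_mul_cancel₀ _ hn.ne']
    push_cast
    have := min_le_right ((n:ℝ)+1) ((q:ℝ)+1)
    nlinarith
end

section
variable {E : Type*} [NormedAddCommGroup E] [NormedSpace ℝ E] [MeasureSpace E] [BorelSpace E]
  [FiniteDimensional ℝ E] [SecondCountableTopology E] [(volume : Measure E).IsAddHaarMeasure]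

instance haarProd {F : Type*} [NormedAddCommGroup F] [NormedSpace ℝ F] [MeasureSpace F] [BorelSpace F]
  [FiniteDimensional ℝ F] [SecondCountableTopology F] [(volume : Measure F).IsAddHaarMeasure] :
    (volume : Measure (E × F)).IsAddHaarMeasure :=
  inferInstanceAs ((volume : Measure E).prod (volume : Measure F)).IsAddHaarMeasure

lemma fubini_K {K : Set (E × ℝ)} (hK : IsCompact K) (f : BoundedContinuousFunction E ℝ) :
    ∫ q in K, f q.1 = ∫ x, f x * flen K x := by
  have hmK : MeasurableSet K := hK.isClosed.measurableSet
  have hint : IntegrableOn (fun q : E × ℝ => f q.1) K := by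
    have : Continuous (fun q : E × ℝ => f q.1) := f.continuous.comp continuous_fst
    exact this.continuousOn.integrableOn_compact hK
  rw [← integral_indicator hmK]
  have h2 := (integrable_indicator_iff hmK).2 hint
  rw [Measure.volume_eq_prod] at h2 ⊢
  rw [integral_prod _ h2]
  congr 1
  ext x
  have : ∀ y, K.indicator (fun q : E × ℝ => f q.1) (x, y)
      = {y | (x, y) ∈ K}.indicator (fun _ => f x) y := by
    intro y; simp [Set.indicator]
  simp only [this]
  have hm : MeasurableSet {y | (x, y) ∈ K} := hmK.preimage (by fun_prop)
  rw [integral_indicator hm, setIntegral_const, smul_eq_mul, mul_comm]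
  rfl

lemma ccu_fst_body (ν : Measure (E × ℝ)) (hν : ν ∈ UB (E × ℝ)) : CCU (ν.map Prod.fst) := by
  obtain ⟨K, hK, hc, hi, hs, rfl⟩ := hν
  intro B hB hU
  have h0 := zero_int hs hc hi
  have hcl : Topology.IsClosedEmbedding (fun y : ℝ => ((0:E), y)) := by
    exact Topology.IsClosedEmbedding.of_continuous_injective_isClosedMap (by fun_prop)
      (fun a b h => (Prod.ext_iff.1 h).2) (isClosedMap_prodMk_left 0)
  have hcomp : IsCompact {y | ((0:E), y) ∈ K} := hcl.isCompact_preimage hK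
  obtain ⟨R, hRK, hRmax⟩ := hcomp.exists_isGreatest ⟨0, (interior_subset h0 : (0 : E × ℝ) ∈ K)⟩
  have hR : 0 < R := by
    have hcont : Filter.Tendsto (fun y : ℝ => ((0:E), y)) (nhds 0) (nhds 0) := by
      have : Continuous (fun y : ℝ => ((0:E), y)) := by fun_prop
      exact this.tendsto 0
    have := hcont (mem_interior_iff_mem_nhds.1 h0)
    obtain ⟨ε, hε, hb⟩ := Metric.mem_nhds_iff.1 this
    have h1 : ε / 2 ∈ Metric.ball (0:ℝ) ε := by
      rw [Metric.mem_ball, Real.dist_eq, sub_zero, abs_of_pos (by positivity)]; linarith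
    have := hRmax (hb h1)
    linarith
  set L := 2 * R with hL
  have hL0 : 0 < L := by positivity
  have hmaxL : ∀ s x, x ∈ lev K s → s ≤ L := by
    intro s x hx
    have := hRmax (lev_zero hs hc hx)
    linarith
  have hflen0 : ∀ x, 0 ≤ flen K x := fun x => measureReal_nonneg
  have hflenL : ∀ x, flen K x ≤ L := by
    intro x
    by_cases hx : x ∈ lev K 0
    · exact hmaxL _ x ((mem_lev_iff hK hc (hflen0 x) hx).2 le_rfl)
    · rw [flen_zero hx]; exact hL0.le
  have hsub : ∀ s, lev K s ⊆ lev K 0 := by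
    rintro s x ⟨y, h1, h2⟩
    exact ⟨y, h1, by simpa using h1⟩
  set A : ℕ → ℕ → Set E := fun n k => lev K (k * L / (n + 1)) with hA
  have hAc : ∀ n k, IsCompact (A n k) := fun n k => lev_compact hK _
  have hAm : ∀ n k, MeasurableSet (A n k) := fun n k => (hAc n k).isClosed.measurableSet
  have hAi : ∀ n k, k ≤ n → (interior (A n k)).Nonempty := by
    intro n k hk
    refine lev_int hs hc hi hRK (by positivity) ?_
    rw [div_lt_iff₀ (by positivity), mul_comm]
    have : (k:ℝ) ≤ n := by exact_mod_cast hk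
    exact mul_lt_mul_of_pos_left (by linarith) hL0
  have hA0 : ∀ n k, k ≤ n → volume (A n k) ≠ 0 := fun n k hk =>
    (Measure.measure_pos_of_nonempty_interior _ (hAi n k hk)).ne'
  have hAt : ∀ n k, volume (A n k) ≠ ∞ := fun n k => (hAc n k).measure_lt_top.ne
  have hK0 : volume K ≠ 0 := (Measure.measure_pos_of_nonempty_interior _ hi).ne'
  have hKt : volume K ≠ ∞ := hK.measure_lt_top.ne
  have hmem : ∀ n, _ := fun n => mix_mem hB (A n) n (hA0 n) (fun k _ => hAt n k)
    (fun k hk => hU ⟨A n k, hAc n k, lev_convex hc _, hAi n k hk, lev_neg hs _, rfl⟩)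
  have hprob : IsProbabilityMeasure ((volume : Measure (E × ℝ))[|K]) :=
    cond_isProbabilityMeasure_of_finite hK0 hKt
  refine hB.2 _ hmem _ (Measure.isProbabilityMeasure_map measurable_fst.aemeasurable) ?_
  have hi_f : ∀ (f : BoundedContinuousFunction E ℝ) n k, IntegrableOn f (A n k) := fun f n k =>
    f.continuous.continuousOn.integrableOn_compact (hAc n k)
  have H : ∀ f : BoundedContinuousFunction E ℝ,
      Filter.Tendsto (fun n : ℕ => L / (n+1) * ∑ k ∈ Finset.range (n+1), ∫ x in A n k, f x)
        Filter.atTop (nhds (∫ x, f x * flen K x)) := by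
    intro f
    have e1 : ∀ n : ℕ, L / (n+1) * ∑ k ∈ Finset.range (n+1), ∫ x in A n k, f x
        = ∫ x in lev K 0, f x * (L / (n+1) * ∑ k ∈ Finset.range (n+1),
          (A n k).indicator (fun _ => (1:ℝ)) x) := by
      intro n
      have e2 : ∀ k, ∫ x in A n k, f x = ∫ x in lev K 0, (A n k).indicator f x := by
        intro k
        rw [setIntegral_indicator (hAm n k), Set.inter_eq_right.2 (hsub _)]
      simp only [e2]
      rw [← integral_finsetSum, ← integral_const_mul]
      · congr 1; ext x
        rw [Finset.mul_sum, Finset.mul_sum, Finset.mul_sum]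
        refine Finset.sum_congr rfl fun k _ => ?_
        by_cases hx : x ∈ A n k <;> simp [hx]; ring
      · intro k _
        exact ((integrable_indicator_iff (hAm n k)).2 (hi_f f n k)).restrict
    have e3 : ∫ x, f x * flen K x = ∫ x in lev K 0, f x * flen K x := by
      rw [setIntegral_eq_integral_of_forall_compl_eq_zero]
      intro x hx; rw [flen_zero hx, mul_zero]
    simp only [e1]
    rw [e3]
    have hfin : IsFiniteMeasure ((volume : Measure E).restrict (lev K 0)) :=
      ⟨by rw [Measure.restrict_apply_univ]; exact (lev_compact hK 0).measure_lt_top⟩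
    refine tendsto_integral_of_dominated_convergence (fun _ => ‖f‖ * L) ?_ (integrable_const _) ?_ ?_
    · intro n
      refine Measurable.aestronglyMeasurable ?_
      refine f.continuous.measurable.mul (Measurable.const_mul ?_ _)
      exact Finset.measurable_sum _ fun k _ => measurable_const.indicator (hAm n k)
    · intro n
      refine Filter.Eventually.of_forall fun x => ?_
      rw [norm_mul]
      refine mul_le_mul (f.norm_coe_le_norm x) ?_ (norm_nonneg _) (norm_nonneg _)
      have hn : (0:ℝ) < n + 1 := by positivity
      have p1 : 0 ≤ ∑ k ∈ Finset.range (n+1), (A n k).indicator (fun _ => (1:ℝ)) x :=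
        Finset.sum_nonneg fun k _ => Set.indicator_nonneg (by simp) _
      have p2 : ∑ k ∈ Finset.range (n+1), (A n k).indicator (fun _ => (1:ℝ)) x ≤ n + 1 := by
        refine (Finset.sum_le_card_nsmul _ _ 1 fun k _ => ?_).trans (by simp)
        exact Set.indicator_le_self' (by simp) _
      rw [Real.norm_of_nonneg (by positivity), div_mul_eq_mul_div, div_le_iff₀ hn]
      gcongr
    · refine (ae_restrict_iff' (lev_compact hK 0).isClosed.measurableSet).2 ?_
      refine Filter.Eventually.of_forall fun x hx => ?_
      refine Filter.Tendsto.const_mul _ ?_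
      convert count_lim hL0 (hflen0 x) (hflenL x) using 4 with n k
      have := mem_lev_iff hK hc (s := k * L / (n+1)) (by positivity) hx
      simp only [Set.indicator, hA, this]
  intro f
  have hfub := fubini_K hK f
  have hfub1 := fubini_K hK (BoundedContinuousFunction.const E (1:ℝ))
  have H1 := H (BoundedContinuousFunction.const E (1:ℝ))
  rw [← hfub1] at H1
  have Hf := H f
  rw [← hfub] at Hf
  simp only [BoundedContinuousFunction.const_apply, setIntegral_const, smul_eq_mul, mul_one] at H1
  have hKr : volume.real K ≠ 0 := by
    rw [measureReal_def]; exact ENNReal.toReal_ne_zero.2 ⟨hK0, hKt⟩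
  have hdiv := Hf.div H1 hKr
  have hlim : ∫ x, f x ∂(((volume : Measure (E × ℝ))[|K]).map Prod.fst)
      = (∫ q in K, f q.1) / volume.real K := by
    rw [integral_map measurable_fst.aemeasurable f.continuous.measurable.aestronglyMeasurable]
    unfold ProbabilityTheory.cond
    rw [integral_smul_measure, ENNReal.toReal_inv, smul_eq_mul, div_eq_inv_mul]; rfl
  rw [hlim]
  refine hdiv.congr fun n => ?_
  have hn : (0:ℝ) < n + 1 := by positivity
  have hq : L / ((n:ℝ)+1) ≠ 0 := by positivity
  simp only [Pi.div_apply]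
  rw [mul_div_mul_left _ _ hq, integral_smul_measure, integral_finsetSum_measure]
  · rw [ENNReal.toReal_inv, ENNReal.toReal_sum (fun k _ => hAt n k), smul_eq_mul, div_eq_inv_mul]
    rfl
  · intro k _; exact hi_f f n k

lemma ccu_fst (μ : Measure (E × ℝ)) (h : CCU μ) : CCU (μ.map Prod.fst) :=
  ccu_push (ContinuousLinearMap.fst ℝ E ℝ) (fun ν hν => ccu_fst_body ν hν) μ h
end

section
set_option linter.unusedSectionVars false
variable {E F : Type*} [NormedAddCommGroup E] [NormedSpace ℝ E] [MeasureSpace E] [BorelSpace E]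
  [FiniteDimensional ℝ E] [SecondCountableTopology E] [(volume : Measure E).IsAddHaarMeasure]
  [NormedAddCommGroup F] [NormedSpace ℝ F] [MeasureSpace F] [BorelSpace F]
  [FiniteDimensional ℝ F] [SecondCountableTopology F] [(volume : Measure F).IsAddHaarMeasure]

lemma ccu_bij (f : E →ₗ[ℝ] F) (hf : Function.Bijective f) (μ : Measure E) (h : CCU μ) :
    CCU (μ.map f) :=
  ccu_equiv (LinearEquiv.ofBijective f hf).toContinuousLinearEquiv μ h

lemma ccu_snd_pi (m : ℕ) (μ : Measure ((Fin m → ℝ) × F)) (h : CCU μ) : CCU (μ.map Prod.snd) := by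
  induction m with
  | zero =>
    refine ccu_bij (LinearMap.snd ℝ (Fin 0 → ℝ) F) ⟨?_, ?_⟩ μ h
    · rintro ⟨a, b⟩ ⟨a', b'⟩ hh
      exact Prod.ext (Subsingleton.elim _ _) hh
    · intro b; exact ⟨(0, b), rfl⟩
  | succ m ih =>
    let e : ((Fin (m+1) → ℝ) × F) →ₗ[ℝ] (((Fin m → ℝ) × F) × ℝ) :=
      { toFun := fun q => ((fun i => q.1 i.succ, q.2), q.1 0)
        map_add' := fun _ _ => rfl
        map_smul' := fun _ _ => rfl }
    have he : Function.Bijective e := by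
      constructor
      · rintro ⟨a, b⟩ ⟨a', b'⟩ hh
        simp only [e, LinearMap.coe_mk, AddHom.coe_mk, Prod.mk.injEq] at hh
        refine Prod.ext (funext fun i => ?_) hh.1.2
        refine Fin.cases hh.2 (fun j => congrFun hh.1.1 j) i
      · rintro ⟨⟨a, b⟩, c⟩
        exact ⟨(Fin.cons c a, b), by simp [e]⟩
    have h3 := ih _ (ccu_fst _ (ccu_bij e he μ h))
    have hem : Measurable e := e.continuous_of_finiteDimensional.measurable
    rw [Measure.map_map measurable_fst hem, Measure.map_map measurable_snd (measurable_fst.comp hem)] at h3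
    exact h3

lemma ccu_shear (m : ℕ) (f : (Fin m → ℝ) →ₗ[ℝ] F) (ε : ℝ) (hε : ε ≠ 0)
    (μ : Measure ((Fin m → ℝ) × F)) (h : CCU μ) : CCU (μ.map (fun q => f q.1 + ε • q.2)) := by
  let e : ((Fin m → ℝ) × F) →ₗ[ℝ] ((Fin m → ℝ) × F) :=
    (LinearMap.fst ℝ _ _).prod (f ∘ₗ LinearMap.fst ℝ _ _ + ε • LinearMap.snd ℝ _ _)
  have he : Function.Bijective e := by
    constructor
    · rintro ⟨a, b⟩ ⟨a', b'⟩ hh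
      have h1 : a = a' := congrArg Prod.fst hh
      have h2 : f a + ε • b = f a' + ε • b' := congrArg Prod.snd hh
      subst h1
      simpa [hε] using h2
    · rintro ⟨a, b⟩
      exact ⟨(a, ε⁻¹ • (b - f a)), by simp [e, smul_smul, hε]⟩
  have hem : Measurable e := e.continuous_of_finiteDimensional.measurable
  have h3 := ccu_snd_pi m _ (ccu_bij e he μ h)
  rw [Measure.map_map measurable_snd hem] at h3
  exact h3

lemma ub_prod {K : Set E} {D : Set F} (h1 : IsCompact K) (h2 : Convex ℝ K)
    (h3 : (interior K).Nonempty) (h4 : K = -K) (g1 : IsCompact D) (g2 : Convex ℝ D)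
    (g3 : (interior D).Nonempty) (g4 : D = -D) :
    ((volume : Measure E)[|K]).prod ((volume : Measure F)[|D]) ∈ UB (E × F) := by
  refine ⟨K ×ˢ D, h1.prod g1, h2.prod g2, ?_, ?_, ?_⟩
  · rw [interior_prod_eq]; exact h3.prod g3
  · conv_lhs => rw [h4, g4]
    ext q; simp
  · unfold ProbabilityTheory.cond
    rw [Measure.volume_eq_prod, Measure.prod_prod, ← Measure.prod_restrict,
      Measure.prod_smul_left, Measure.prod_smul_right, smul_smul,
      ENNReal.mul_inv (Or.inr g1.measure_lt_top.ne) (Or.inl h1.measure_lt_top.ne)]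

lemma ccu_lin_body (m : ℕ) (f : (Fin m → ℝ) →ₗ[ℝ] F) (ν : Measure (Fin m → ℝ))
    (hν : ν ∈ UB (Fin m → ℝ)) : CCU (ν.map f) := by
  obtain ⟨K, hK, hc, hi, hs, rfl⟩ := hν
  have hfc : Continuous f := f.continuous_of_finiteDimensional
  set D : Set F := Metric.closedBall 0 1
  have hDc : IsCompact D := by
    have : ProperSpace F := FiniteDimensional.proper ℝ F
    exact isCompact_closedBall _ _
  have hDi : (interior D).Nonempty :=
    ⟨0, interior_mono Metric.ball_subset_closedBall (by simp [Metric.isOpen_ball.interior_eq])⟩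
  have hP := ub_prod hK hc hi hs hDc (convex_closedBall _ _) hDi (by ext; simp [D])
  have p1 : IsProbabilityMeasure ((volume : Measure (Fin m → ℝ))[|K]) :=
    cond_isProbabilityMeasure_of_finite (Measure.measure_pos_of_nonempty_interior _ hi).ne'
      hK.measure_lt_top.ne
  have p2 : IsProbabilityMeasure ((volume : Measure F)[|D]) :=
    cond_isProbabilityMeasure_of_finite (Measure.measure_pos_of_nonempty_interior _ hDi).ne'
      hDc.measure_lt_top.ne
  set P := ((volume : Measure (Fin m → ℝ))[|K]).prod ((volume : Measure F)[|D])
  intro B hB hU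
  have hmem : ∀ n : ℕ, P.map (fun q => f q.1 + (1 / ((n:ℝ) + 1)) • q.2) ∈ B := fun n =>
    ccu_shear m f (1 / ((n:ℝ)+1)) (by positivity) P (ccu_of_ub hP) B hB hU
  refine hB.2 _ hmem _ (Measure.isProbabilityMeasure_map hfc.measurable.aemeasurable) ?_
  intro g
  have e0 : ((volume : Measure (Fin m → ℝ))[|K]) = P.map Prod.fst := by
    simp [P, Measure.map_fst_prod]
  rw [e0, Measure.map_map hfc.measurable measurable_fst,
    integral_map (hfc.measurable.comp measurable_fst).aemeasurable
      g.continuous.measurable.aestronglyMeasurable]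
  have e1 : ∀ n : ℕ, ∫ x, g x ∂(P.map (fun q => f q.1 + (1 / ((n:ℝ) + 1)) • q.2))
      = ∫ q, g (f q.1 + (1 / ((n:ℝ) + 1)) • q.2) ∂P := by
    intro n
    exact integral_map (Continuous.measurable (by fun_prop)).aemeasurable
      g.continuous.measurable.aestronglyMeasurable
  simp only [e1]
  refine tendsto_integral_of_dominated_convergence (fun _ => ‖g‖) ?_ (integrable_const _) ?_ ?_
  · intro n
    exact (Continuous.measurable (by fun_prop)).aestronglyMeasurable
  · intro n
    exact Filter.Eventually.of_forall fun q => g.norm_coe_le_norm _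
  · refine Filter.Eventually.of_forall fun q => ?_
    refine (g.continuous.tendsto _).comp ?_
    have := ((tendsto_one_div_add_atTop_nhds_zero_nat (𝕜 := ℝ)).smul_const q.2).const_add (f q.1)
    simpa using this

end

/-- If `ψ` (with law `μ` on `ℝ^m`) is central convex unimodal, then for any matrix
`C ∈ ℝ^{p×m}` (not necessarily of full rank), `Cψ` is central convex unimodal. -/
theorem stmt9 (m p : ℕ) (μ : Measure (Fin m → ℝ)) [IsProbabilityMeasure μ]
    (hμ : IsCCU μ) (C : Matrix (Fin p) (Fin m) ℝ) :
    IsCCU (μ.map (fun x => C.mulVec x)) := by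
  have h : CCU μ := hμ
  have := ccu_push (Matrix.mulVecLin C).toContinuousLinearMap
    (fun ν hν => ccu_lin_body m (Matrix.mulVecLin C) ν hν) μ h
  exact this
end
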